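/- arXiv:1801.01231 — 2 statements merged into one kernel-verified Lean document; each statement's English description precedes it below -/
import Mathlib

section
/- Black spider fusion: for all p, q, r, s ∈ ℕ, connecting one leg of a black spider to one leg of another through a binary black vertex merges them into a single black spider; precisely, (id_{Q^{⊗q}} ⊗ (B_{r+1,s} ∘ (X ⊗ id_{Q^{⊗r}}))) ∘ (B_{p,q+1} ⊗ id_{Q^{⊗r}}) = B_{p+r, q+s} as linear maps Q^{⊗(p+r)} → Q^{⊗(q+s)}. -/
/-- Bitstrings of length `n`, indexing the standard basis of `Q^{⊗n}` where `Q = ℂ²`. -/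
abbrev BStr (n : ℕ) : Type := Fin n → Bool

/-- Vectors of `Q^{⊗n}`, given by their coordinates over the bitstring basis. -/
abbrev Vec (n : ℕ) : Type := BStr n → ℂ

/-- Linear maps `Q^{⊗n} → Q^{⊗m}`, represented as matrices indexed by bitstrings;
composition is matrix multiplication and tensor product is the Kronecker product. -/
abbrev QMap (n m : ℕ) : Type := Matrix (BStr m) (BStr n) ℂ

noncomputable section

/-- Kronecker (tensor) product of maps, under the identification
`Q^{⊗n} ⊗ Q^{⊗p} ≅ Q^{⊗(n+p)}`. -/
def tensM {n m p q : ℕ} (A : QMap n m) (B : QMap p q) : QMap (n + p) (m + q) :=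
  Matrix.of fun b a =>
    A (fun i => b (Fin.castAdd q i)) (fun i => a (Fin.castAdd p i)) *
      B (fun j => b (Fin.natAdd m j)) (fun j => a (Fin.natAdd n j))

/-- Recasting a map along equalities of the numbers of wires (the canonical
identification of tensor powers). -/
def castM {n m n' m' : ℕ} (hn : n = n') (hm : m = m') (A : QMap n m) : QMap n' m' :=
  Matrix.of fun b a => A (fun i => b (Fin.cast hm i)) (fun i => a (Fin.cast hn i))

/-- `|a|`: the number of 1s in a bitstring. -/
def wt {n : ℕ} (a : BStr n) : ℕ := (Finset.univ.filter fun i => a i = true).card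

/-- Standard basis vector `e_a`. -/
def basisV {n : ℕ} (a : BStr n) : Vec n := fun b => if b = a then 1 else 0

/-- Tensor product of vectors. -/
def tensVec {n m : ℕ} (v : Vec n) (w : Vec m) : Vec (n + m) :=
  fun a => v (fun i => a (Fin.castAdd m i)) * w (fun j => a (Fin.natAdd n j))

/-- Identity on one wire. -/
def idQ : QMap 1 1 := 1

/-- Identity on `n` wires. -/
def idN (n : ℕ) : QMap n n := 1

/-- Tensor symmetry `σ : v ⊗ w ↦ w ⊗ v`. -/
def sigmaM : QMap 2 2 :=
  Matrix.of fun b a => if b 0 = a 1 ∧ b 1 = a 0 then 1 else 0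

/-- The fermionic swap `F : e_a ⊗ e_b ↦ (−1)^{ab} e_b ⊗ e_a`. -/
def FM : QMap 2 2 :=
  Matrix.of fun b a =>
    if b 0 = a 1 ∧ b 1 = a 0 then (if a 0 && a 1 then -1 else 1) else 0

/-- The cup `η : 1 ↦ e₀⊗e₀ + e₁⊗e₁`. -/
def cupM : QMap 0 2 := Matrix.of fun b _ => if b 0 = b 1 then 1 else 0

/-- The cap `c : e_a ⊗ e_b ↦ δ_{ab}`. -/
def capM : QMap 2 0 := Matrix.of fun _ a => if a 0 = a 1 then 1 else 0

/-- Binary black vertex state `1 ↦ e₁⊗e₀ + e₀⊗e₁`. -/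
def black2S : QMap 0 2 := Matrix.of fun b _ => if b 0 ≠ b 1 then 1 else 0

/-- Ternary black vertex state `1 ↦ e₁⊗e₀⊗e₀ + e₀⊗e₁⊗e₀ + e₀⊗e₀⊗e₁`. -/
def black3S : QMap 0 3 := Matrix.of fun b _ => if wt b = 1 then 1 else 0

/-- Binary white vertex state `1 ↦ e₀⊗e₀ + z·e₁⊗e₁`. -/
def whiteS (z : ℂ) : QMap 0 2 :=
  Matrix.of fun b _ =>
    if b 0 = false ∧ b 1 = false then 1 else if b 0 = true ∧ b 1 = true then z else 0

/-- The white vertex `W_z : e₀ ↦ e₀, e₁ ↦ z·e₁`. -/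
def Wmap (z : ℂ) : QMap 1 1 :=
  Matrix.of fun b a => if b = a then (if a 0 then z else 1) else 0

/-- The Pauli `Z` gate: `e₀ ↦ e₀, e₁ ↦ −e₁`. -/
def Zm : QMap 1 1 :=
  Matrix.of fun b a => if b = a then (if a 0 then -1 else 1) else 0

/-- The Pauli `X` gate: `e₀ ↦ e₁, e₁ ↦ e₀`. -/
def Xm : QMap 1 1 := Matrix.of fun b a => if b 0 = a 0 then 0 else 1

/-- The fermionic line multiplication `m`. -/
def mMul : QMap 2 1 :=
  Matrix.of fun b a =>
    match a 0, a 1, b 0 with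
    | false, false, false => 1
    | true, false, true => 1
    | false, true, true => 1
    | _, _, _ => 0

/-- The fermionic line unit `u : 1 ↦ e₀`. -/
def uM : QMap 0 1 := Matrix.of fun b _ => if b 0 = false then 1 else 0

/-- The fermionic line comultiplication `Δ`. -/
def deltaM : QMap 1 2 :=
  Matrix.of fun b a =>
    match a 0, b 0, b 1 with
    | false, false, false => 1
    | true, true, false => 1
    | true, false, true => 1
    | _, _, _ => 0

/-- The fermionic line counit `ε : e₀ ↦ 1, e₁ ↦ 0`. -/
def epsM : QMap 1 0 := Matrix.of fun _ a => if a 0 = false then 1 else 0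

/-- The even projector `P` on two wires. -/
def Pm : QMap 2 2 := Matrix.of fun b a => if b = a ∧ a 0 = a 1 then 1 else 0

/-- The beam splitter `BS(r,t)`. -/
def BS (r t : ℂ) : QMap 2 2 :=
  Matrix.of fun b a =>
    match a 0, a 1, b 0, b 1 with
    | false, false, false, false => 1
    | true, false, true, false => r
    | true, false, false, true => t
    | false, true, true, false => -((starRingEnd ℂ) t)
    | false, true, false, true => (starRingEnd ℂ) r
    | true, true, true, true => 1
    | _, _, _, _ => 0

/-- The black spider `B_{n,m}`: matrix entry at `(b,a)` is 1 if `|a|+|b| = 1` and 0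
otherwise. -/
def bspider (n m : ℕ) : QMap n m :=
  Matrix.of fun b a => if wt a + wt b = 1 then 1 else 0

/-- The white spider `V^z_{n,m}`: entry 1 at the all-0 corner and `z` at the all-1
corner, 0 elsewhere. -/
def wspider (z : ℂ) (n m : ℕ) : QMap n m :=
  Matrix.of fun b a =>
    (if (∀ i, a i = false) ∧ (∀ j, b j = false) then 1 else 0) +
      (if (∀ i, a i = true) ∧ (∀ j, b j = true) then z else 0)

/-- Entry of a binary white vertex, as a `Bool`-indexed matrix. -/
def Wentry (z : ℂ) (b a : Bool) : ℂ := if b = a then (if a then z else 1) else 0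

/-- `n`-fold Kronecker product `W_{z₁} ⊗ ⋯ ⊗ W_{zₙ}` of white vertices. -/
def whites {n : ℕ} (z : Fin n → ℂ) : QMap n n :=
  Matrix.of fun b a => ∏ i, Wentry (z i) (b i) (a i)

/-- The bitstring of length `n` with a single 1 in position `k`. -/
def deltaStr {n : ℕ} (k : Fin n) : BStr n := fun i => decide (i = k)

/-- The black spider state `b_n = Σ_{k<n} e_{δ_k}`. -/
def bvec (n : ℕ) : Vec n := ∑ k : Fin n, basisV (deltaStr k)

/-- The white spider state `G_{n,z} = e_{0…0} + z·e_{1…1}`. -/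
def Gvec (n : ℕ) (z : ℂ) : Vec n :=
  basisV (fun _ => false) + z • basisV (fun _ => true)

/-- The even subspace of `Q^{⊗n}`: span of the `e_a` with `|a|` even. -/
def evenSub (n : ℕ) : Submodule ℂ (Vec n) :=
  Submodule.span ℂ {v | ∃ a : BStr n, Even (wt a) ∧ v = basisV a}

/-- The odd subspace of `Q^{⊗n}`: span of the `e_a` with `|a|` odd. -/
def oddSub (n : ℕ) : Submodule ℂ (Vec n) :=
  Submodule.span ℂ {v | ∃ a : BStr n, Odd (wt a) ∧ v = basisV a}

/-- A map is even if it preserves the parity grading. -/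
def IsEvenMap {n m : ℕ} (A : QMap n m) : Prop :=
  (∀ v ∈ evenSub n, A.mulVec v ∈ evenSub m) ∧ ∀ v ∈ oddSub n, A.mulVec v ∈ oddSub m

/-- A map is odd if it reverses the parity grading. -/
def IsOddMap {n m : ℕ} (A : QMap n m) : Prop :=
  (∀ v ∈ evenSub n, A.mulVec v ∈ oddSub m) ∧ ∀ v ∈ oddSub n, A.mulVec v ∈ evenSub m

/-- A map is pure if it is even or odd. -/
def IsPure {n m : ℕ} (A : QMap n m) : Prop := IsEvenMap A ∨ IsOddMap A

theorem wt_eq_sum {n : ℕ} (a : BStr n) : wt a = ∑ i, (a i).toNat := by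
  rw [wt, Finset.card_filter]
  exact Finset.sum_congr rfl fun i _ => by cases a i <;> rfl

theorem wt_add {n m : ℕ} (a : BStr (n + m)) :
    wt a = wt (fun i => a (Fin.castAdd m i)) + wt (fun j => a (Fin.natAdd n j)) := by
  simp only [wt_eq_sum, Fin.sum_univ_add]

theorem wt_cons {n : ℕ} (x : Bool) (a : BStr n) :
    wt (Fin.cons x a : BStr (n + 1)) = x.toNat + wt a := by
  simp [wt_eq_sum, Fin.sum_univ_succ]

theorem sum_bstr_succ {n : ℕ} (f : BStr (n + 1) → ℂ) :
    ∑ y, f y = ∑ x : Bool, ∑ v : BStr n, f (Fin.cons x v) := by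
  rw [← (Fin.consEquiv fun _ : Fin (n + 1) => Bool).sum_comp, Fintype.sum_prod_type]
  rfl

theorem sum_bstr_add {n m : ℕ} (f : BStr (n + m) → ℂ) :
    ∑ y, f y = ∑ u : BStr n, ∑ v : BStr m, f (Fin.append u v) := by
  rw [← (Fin.appendEquiv n m).sum_comp, Fintype.sum_prod_type]
  rfl

/-- Entries of `X ⊗ id`, with the first wire split off. -/
theorem castM_tensM_Xm_cons {r : ℕ} (x y : Bool) (u v : BStr r) :
    castM (Nat.add_comm 1 r) (Nat.add_comm 1 r) (tensM Xm (idN r))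
      (Fin.cons y u) (Fin.cons x v) = if y = !x then if u = v then 1 else 0 else 0 := by
  have h0 : Fin.cast (Nat.add_comm 1 r) (Fin.castAdd r 0) = 0 := rfl
  have hs (j : Fin r) : Fin.cast (Nat.add_comm 1 r) (Fin.natAdd 1 j) = j.succ := by
    ext; simp
  simp only [castM, tensM, Xm, idN, Matrix.of_apply, h0, hs, Fin.cons_zero, Fin.cons_succ,
    Matrix.one_apply]
  cases x <;> cases y <;> simp

theorem bspider_mul_Xm_cons {r s : ℕ} (b : BStr s) (x : Bool) (v : BStr r) :
    (bspider (r + 1) s *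
      castM (Nat.add_comm 1 r) (Nat.add_comm 1 r) (tensM Xm (idN r))) b (Fin.cons x v) =
      if (!x).toNat + wt v + wt b = 1 then 1 else 0 := by
  rw [Matrix.mul_apply, sum_bstr_succ]
  simp only [castM_tensM_Xm_cons]
  cases x <;> simp [bspider, wt_cons]

theorem tensM_apply_append {n m p q : ℕ} (A : QMap n m) (B : QMap p q) (b : BStr (m + q))
    (u : BStr n) (v : BStr p) :
    tensM A B b (Fin.append u v) =
      A (fun i => b (Fin.castAdd q i)) u * B (fun j => b (Fin.natAdd m j)) v := by
  simp only [tensM, Matrix.of_apply, Fin.append_left, Fin.append_right]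

/-- Entries of `B ⊗ id`, with the last output leg of the black spider split off. -/
theorem castM_tensM_bspider_append {p q r : ℕ} (u : BStr q) (x : Bool) (v : BStr r)
    (a : BStr (p + r)) (h : (q + 1) + r = q + (r + 1)) :
    castM rfl h (tensM (bspider p (q + 1)) (idN r))
      (Fin.append u (Fin.cons x v)) a =
      if v = (fun j => a (Fin.natAdd p j)) then
        if wt (fun i => a (Fin.castAdd r i)) + (wt u + x.toNat) = 1 then 1 else 0
      else 0 := by
  have hl (i : Fin q) : Fin.cast h
      (Fin.castAdd r (Fin.castAdd 1 i)) = Fin.castAdd (r + 1) i := rfl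
  have hm (i : Fin 1) : Fin.cast h
      (Fin.castAdd r (Fin.natAdd q i)) = Fin.natAdd q 0 := by
    ext; simp
  have hr (j : Fin r) : Fin.cast h
      (Fin.natAdd (q + 1) j) = Fin.natAdd q j.succ := by
    ext; simp; omega
  have hx : wt (fun _ : Fin 1 => x) = x.toNat := by simp [wt_eq_sum]
  simp only [castM, tensM, bspider, idN, Matrix.of_apply, wt_add (n := q) (m := 1), hl, hm, hr,
    Fin.append_left, Fin.append_right, Fin.cons_zero, Fin.cons_succ, Matrix.one_apply, hx,
    Fin.cast_refl, id]
  simp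

/-- **Black spider fusion**: connecting one leg of a black spider to one leg of
another through a binary black vertex merges them into a single black spider. -/
theorem black_spider_fusion (p q r s : ℕ) :
    tensM (idN q)
        (bspider (r + 1) s *
          castM (Nat.add_comm 1 r) (Nat.add_comm 1 r) (tensM Xm (idN r))) *
      castM rfl (by omega : (q + 1) + r = q + (r + 1))
        (tensM (bspider p (q + 1)) (idN r)) =
    bspider (p + r) (q + s) := by
  ext b a
  rw [Matrix.mul_apply, sum_bstr_add]
  simp only [sum_bstr_succ, castM_tensM_bspider_append, tensM_apply_append,
    bspider_mul_Xm_cons]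
  simp only [idN, Matrix.one_apply, bspider, Matrix.of_apply, wt_add a, wt_add b]
  generalize (fun i => a (Fin.castAdd r i)) = a₁
  generalize (fun j => a (Fin.natAdd p j)) = a₂
  generalize (fun i => b (Fin.castAdd s i)) = b₁
  generalize (fun j => b (Fin.natAdd q j)) = b₂
  simp only [mul_ite, mul_one, mul_zero, Fintype.sum_bool,
    Finset.sum_ite_eq', Finset.mem_univ, if_true, Bool.not_true, Bool.not_false,
    Bool.toNat_true, Bool.toNat_false, Finset.sum_add_distrib]
  rw [Finset.sum_eq_single b₁, Finset.sum_eq_single b₁]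
  all_goals grind
end
end

section
/- Disconnection law: for every n ≥ 2 and all q, k ∈ ℕ and z ∈ ℂ, feeding n legs of a white spider state into a black spider disconnects the diagram and erases the parameter: (B_{n,q} ⊗ id_{Q^{⊗k}})(G_{n+k,z}) = b_q ⊗ e₀^{⊗k} in Q^{⊗(q+k)}. -/
noncomputable section

theorem wt_false (n : ℕ) : wt (fun _ : Fin n => false) = 0 := by
  simp [wt]

theorem wt_true (n : ℕ) : wt (fun _ : Fin n => true) = n := by
  simp [wt]

theorem wt_eq_one_iff {n : ℕ} (b : BStr n) : wt b = 1 ↔ ∃ k, b = deltaStr k := by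
  rw [wt, Finset.card_eq_one]
  refine exists_congr fun k => ?_
  rw [Finset.ext_iff, funext_iff]
  refine forall_congr' fun i => ?_
  cases h : b i <;> simp [deltaStr, h]

theorem deltaStr_injective (n : ℕ) : Function.Injective (deltaStr : Fin n → BStr n) := by
  intro i j h
  simpa [deltaStr] using congrFun h i

theorem bvec_apply {n : ℕ} (b : BStr n) : bvec n b = if wt b = 1 then 1 else 0 := by
  simp only [bvec, Finset.sum_apply, basisV, wt_eq_one_iff]
  split_ifs with h
  · obtain ⟨k, rfl⟩ := h
    simp [(deltaStr_injective n).eq_iff]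
  · exact Finset.sum_eq_zero fun k _ => if_neg fun hk => h ⟨k, hk⟩

theorem mulVec_basisV {n m : ℕ} (A : QMap n m) (a : BStr n) (b : BStr m) :
    A.mulVec (basisV a) b = A b a := by
  simp [Matrix.mulVec, dotProduct, basisV]

/-- **Disconnection law**: feeding `n ≥ 2` legs of a white spider state into a black
spider disconnects the diagram and erases the parameter. -/
theorem black_spider_disconnection (n q k : ℕ) (hn : 2 ≤ n) (z : ℂ) :
    (tensM (bspider n q) (idN k)).mulVec (Gvec (n + k) z) =
      tensVec (bvec q) (basisV (fun _ : Fin k => false)) := by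
  funext b
  rw [Gvec, Matrix.mulVec_add, Matrix.mulVec_smul, Pi.add_apply, Pi.smul_apply,
    mulVec_basisV, mulVec_basisV]
  have hne (w : ℕ) : n + w ≠ 1 := by omega
  simp [tensM, tensVec, bspider, idN, Matrix.one_apply, basisV, bvec_apply, wt_false,
    wt_true, hne]
end
end
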